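/- arXiv:2106.10239 — 6 statements merged into one kernel-verified Lean document; each statement's English description precedes it below -/
import Mathlib

section
/- Let k be a field of characteristic two and let f ∈ k[X] be a monic polynomial of degree n ≥ 1. Assume that f is NOT a product of pairwise distinct monic irreducible inseparable polynomials, i.e., it is not the case that f is squarefree and every monic irreducible factor of f is inseparable. Then there exists a symmetric matrix M ∈ M_n(k) whose minimal polynomial over k equals f. -/
open Polynomial

section Form

variable {k : Type*} [Field k]

/-- Over a field of characteristic two, let `B` be a nondegenerate symmetric bilinear form such that
`B x x = τ x ^ 2` for a nonzero linear functional `τ`. Then `B` has an orthonormal basis. -/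
theorem exists_orthonormal_of_apply_self_eq_sq [CharP k 2] (n : ℕ) :
    ∀ {V : Type*} [AddCommGroup V] [Module k V] [FiniteDimensional k V]
      (B : V →ₗ[k] V →ₗ[k] k) (τ : V →ₗ[k] k), Module.finrank k V = n →
      (∀ x y, B x y = B y x) → (∀ x, (∀ y, B x y = 0) → x = 0) →
      (∀ x, B x x = τ x ^ 2) → τ ≠ 0 →
      ∃ v : Fin n → V, ∀ i j, B (v i) (v j) = if i = j then 1 else 0 := by
  induction n with
  | zero => exact fun _ _ _ _ _ _ _ => ⟨Fin.elim0, fun i => i.elim0⟩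
  | succ n ih =>
    intro V _ _ _ B τ hd hs hn hτ hτ0
    obtain ⟨x, hx⟩ : ∃ x, τ x ≠ 0 := by
      by_contra! hc
      exact hτ0 (LinearMap.ext hc)
    have hv0 : τ ((τ x)⁻¹ • x) = 1 := by simp [hx]
    generalize (τ x)⁻¹ • x = v₀ at hv0
    rcases Nat.eq_zero_or_pos n with rfl | hpos
    · refine ⟨fun _ => v₀, fun i j => ?_⟩
      rw [if_pos (by omega), hτ, hv0, one_pow]
    have hker : ∀ v, τ v = 1 → Module.finrank k (LinearMap.ker (B v)) = n := by
      intro v hv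
      have : B v ≠ 0 := fun h0 => by
        have := hτ v
        simp [h0, hv] at this
      have := Module.Dual.finrank_ker_add_one_of_ne_zero this
      omega
    obtain ⟨v, hv, w, hvw, hw⟩ : ∃ v, τ v = 1 ∧ ∃ w, B v w = 0 ∧ τ w ≠ 0 := by
      by_contra! hc
      have : Nontrivial (LinearMap.ker (B v₀)) :=
        Module.nontrivial_of_finrank_pos (R := k) (by rw [hker v₀ hv0]; exact hpos)
      obtain ⟨⟨f, hf⟩, hf0⟩ := exists_ne (0 : LinearMap.ker (B v₀))
      replace hf0 : f ≠ 0 := fun h => hf0 (by simp [h])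
      rw [LinearMap.mem_ker] at hf
      obtain ⟨y, hy⟩ : ∃ y, B f y ≠ 0 := by
        by_contra! hc'
        exact hf0 (hn f hc')
      have hτf : τ f = 0 := hc v₀ hv0 f hf
      have hvv : B v₀ v₀ = 1 := by rw [hτ, hv0, one_pow]
      have hfv : B f v₀ = 0 := by rw [hs, hf]
      set g := (B f y)⁻¹ • (y - B v₀ y • v₀) with hg
      have hvg : B v₀ g = 0 := by simp [hg, hvv]
      have hfg : B f g = 1 := by simp [hg, hfv, hy]
      have hτg : τ g = 0 := hc v₀ hv0 g hvg
      have h2 : (1 : k) + 1 = 0 := CharTwo.add_self_eq_zero 1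
      have := hc (v₀ + f) (by simp [hv0, hτf]) (v₀ + g) (by simp [hvv, hvg, hfv, hfg, h2])
      simp [hv0, hτg] at this
    have hvv : B v v = 1 := by rw [hτ, hv, one_pow]
    let W := LinearMap.ker (B v)
    obtain ⟨b, hb⟩ := ih (V := W) (B.domRestrict₁₂ W W) (τ.domRestrict W) (hker v hv)
      (fun x y => hs x y)
      (fun x hx => by
        apply Subtype.ext
        refine hn x fun y => ?_
        have hvx : B v x = 0 := x.2
        have : B x (y - B v y • v) = 0 := hx ⟨y - B v y • v, by simp [W, hvv]⟩
        simpa [hs (x : V) v, hvx] using this)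
      (fun x => hτ x)
      (fun h0 => hw (by simpa using LinearMap.congr_fun h0 ⟨w, hvw⟩))
    have hvb : ∀ i, B v (b i) = 0 := fun i => (b i).2
    refine ⟨Fin.cons v fun i => (b i : V), fun i j => ?_⟩
    refine Fin.cases ?_ (fun i => ?_) i <;> refine Fin.cases ?_ (fun j => ?_) j
    · simp [hvv]
    · simp [hvb, (Fin.succ_ne_zero _).symm]
    · simp [hs _ v, hvb]
    · have : B (b i) (b j) = _ := hb i j
      simpa using this

end Form

section Poly

variable {k : Type*} [Field k]

theorem derivative_derivative_of_charTwo [CharP k 2] (s : k[X]) :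
    derivative (derivative s) = 0 := by
  ext m
  rw [coeff_derivative, coeff_derivative, coeff_zero, mul_assoc]
  have : ((((m + 1) * (m + 2) : ℕ)) : k) = 0 := by
    rw [CharP.cast_eq_zero_iff k 2]
    exact (Nat.even_mul_succ_self (m + 1)).two_dvd
  push_cast at this ⊢
  linear_combination s.coeff (m + 1 + 1) * this

theorem derivative_eq_zero_of_forall_irreducible_not_separable (i : k[X]) (hi : i ≠ 0)
    (h : ∀ p, Irreducible p → p ∣ i → ¬ p.Separable) : derivative i = 0 := by
  induction i using UniqueFactorizationMonoid.induction_on_prime with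
  | h₁ => exact absurd rfl hi
  | h₂ x hx =>
    obtain ⟨c, -, rfl⟩ := Polynomial.isUnit_iff.1 hx
    exact derivative_C
  | h₃ a p ha hp ih =>
    have h1 : derivative p = 0 := by
      have := h p hp.irreducible (dvd_mul_right _ _)
      rwa [separable_iff_derivative_ne_zero hp.irreducible, not_not] at this
    rw [derivative_mul, h1, ih ha fun q hq hqa => h q hq (hqa.mul_left p)]
    simp

theorem exists_separable_mul_mul_sq (f : k[X]) (hf : f ≠ 0) :
    ∃ s i h : k[X], f = s * i * h ^ 2 ∧ s.Separable ∧ Squarefree (s * i) ∧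
      ∀ p, Irreducible p → p ∣ i → ¬ p.Separable := by
  induction f using UniqueFactorizationMonoid.induction_on_prime with
  | h₁ => exact absurd rfl hf
  | h₂ x hx =>
    refine ⟨x, 1, 1, by simp, ?_, by simpa using hx.squarefree,
      fun p hp hp1 => absurd (isUnit_of_dvd_one hp1) hp.not_isUnit⟩
    simpa using (separable_one (R := k)).mul_unit hx
  | h₃ a p ha hp ih =>
    obtain ⟨s, i, h, rfl, hs, hsq, hi⟩ := ih ha
    by_cases hd : p ∣ s * i
    · rcases hp.dvd_or_dvd hd with ⟨t, rfl⟩ | ⟨t, rfl⟩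
      · exact ⟨t, i, h * p, by ring, hs.of_mul_right,
          hsq.squarefree_of_dvd ⟨p, by ring⟩, hi⟩
      · exact ⟨s, t, h * p, by ring, hs, hsq.squarefree_of_dvd ⟨p, by ring⟩,
          fun q hq hqt => hi q hq (hqt.mul_left p)⟩
    have hco : IsCoprime p (s * i) := (hp.irreducible.coprime_iff_not_dvd).2 hd
    have hsq' : Squarefree (p * (s * i)) :=
      squarefree_mul_iff.2 ⟨hco.isRelPrime, hp.irreducible.squarefree, hsq⟩
    by_cases hsep : p.Separable
    · exact ⟨p * s, i, h, by ring, hsep.mul hs (hco.of_mul_right_left), by rwa [mul_assoc], hi⟩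
    · refine ⟨s, p * i, h, by ring, hs, by rwa [mul_left_comm], fun q hq hqi => ?_⟩
      rcases hq.prime.dvd_or_dvd hqi with hqp | hqi
      · exact fun hqs => hsep (((hq.dvd_irreducible_iff_associated hp.irreducible).1 hqp).separable
          hqs)
      · exact hi q hq hqi

theorem exists_isCoprime_add_sq_mul {a b f : k[X]} (hab : IsCoprime a b) (hf : f ≠ 0) :
    ∃ e : k[X], IsCoprime (a + e ^ 2 * b) f := by
  obtain ⟨e, hea, he⟩ : ∃ e : k[X], IsCoprime e a ∧ ∀ p, Prime p → p ∣ f → ¬ p ∣ a → p ∣ e := by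
    induction f using UniqueFactorizationMonoid.induction_on_prime with
    | h₁ => exact absurd rfl hf
    | h₂ x hx =>
      exact ⟨1, isCoprime_one_left, fun p hp hpx => absurd (isUnit_of_dvd_unit hpx hx) hp.not_isUnit⟩
    | h₃ f p hf' hp ih =>
      obtain ⟨e, hea, he⟩ := ih hf'
      by_cases hpa : p ∣ a
      · refine ⟨e, hea, fun q hq hqf hqa => ?_⟩
        rcases hq.dvd_or_dvd hqf with hqp | hqf
        · exact absurd ((hq.associated_of_dvd hp hqp).dvd.trans hpa) hqa
        · exact he q hq hqf hqa
      · refine ⟨e * p, hea.mul_left ((hp.irreducible.coprime_iff_not_dvd).2 hpa),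
          fun q hq hqf hqa => ?_⟩
        rcases hq.dvd_or_dvd hqf with hqp | hqf
        · exact hqp.mul_left e
        · exact (he q hq hqf hqa).mul_right p
  refine ⟨e, isCoprime_of_prime_dvd (fun h0 => hf h0.2) fun p hp hpu hpf => ?_⟩
  by_cases hpa : p ∣ a
  · rw [dvd_add_right hpa] at hpu
    rcases hp.dvd_or_dvd hpu with h1 | h1
    · exact hp.not_isUnit (hea.isUnit_of_dvd' (hp.dvd_of_dvd_pow h1) hpa)
    · exact hp.not_isUnit (hab.isUnit_of_dvd' hpa h1)
  · have := he p hp hpf hpa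
    exact hpa ((dvd_add_left ((dvd_pow this two_ne_zero).mul_right b)).1 hpu)

/-- If `f` has a separable irreducible factor or is not squarefree, then for some unit `u` modulo `f`
the derivative of `u * f` is the square of a polynomial not divisible by `f`. -/
theorem exists_isCoprime_derivative_mul_eq_sq [CharP k 2] (f : k[X]) (hf : f ≠ 0)
    (h : ¬ (Squarefree f ∧ ∀ g : k[X], g.Monic → Irreducible g → g ∣ f → ¬ g.Separable)) :
    ∃ u w : k[X], IsCoprime u f ∧ derivative (u * f) = w ^ 2 ∧ ¬ f ∣ w := by
  have h2 : (2 : k[X]) = 0 := CharTwo.two_eq_zero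
  obtain ⟨s, i, t, hfe, hs, hsq, hi⟩ := exists_separable_mul_mul_sq f hf
  have hi0 : i ≠ 0 := by rintro rfl; simp [hfe] at hf
  have ht0 : t ≠ 0 := by rintro rfl; simp [hfe] at hf
  have hdi := derivative_eq_zero_of_forall_irreducible_not_separable i hi0 hi
  by_cases hu : IsUnit s
  · obtain ⟨c, hc, rfl⟩ := Polynomial.isUnit_iff.1 hu
    have htu : ¬ IsUnit t := by
      intro ht
      have hass : Associated (C c * i) f := by
        rw [hfe]
        exact (associated_mul_unit_right _ _ (ht.pow 2))
      refine h ⟨hsq.squarefree_of_dvd hass.symm.dvd, fun g _ hg hgf => hi g hg ?_⟩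
      exact (hu.dvd_mul_left).1 (hgf.trans hass.symm.dvd)
    obtain ⟨e, he⟩ := exists_isCoprime_add_sq_mul (a := X * (C c * i)) (b := 1)
      isCoprime_one_right hf
    refine ⟨_, C c * i * t, he, ?_, ?_⟩
    · rw [hfe]
      simp only [derivative_mul, derivative_add, derivative_pow, hdi, derivative_C, derivative_X,
        derivative_one, Nat.cast_ofNat, map_ofNat, h2]
      ring
    · intro hdvd
      rw [hfe, pow_two, ← mul_assoc] at hdvd
      have h0 : C c * i * t ≠ 0 := mul_ne_zero (mul_ne_zero hu.ne_zero hi0) ht0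
      exact htu (isUnit_of_dvd_one ((mul_dvd_mul_iff_left h0).1 (by simpa using hdvd)))
  · have hsi : IsCoprime s i := (squarefree_mul_iff.1 hsq).1.isCoprime
    have hss : IsCoprime s (derivative s) := hs
    obtain ⟨e, he⟩ := exists_isCoprime_add_sq_mul (a := derivative s * i) (b := s)
      (hss.symm.mul_left hsi.symm) hf
    refine ⟨_, derivative s * i * t, he, ?_, ?_⟩
    · rw [hfe]
      simp only [derivative_mul, derivative_add, derivative_pow, hdi,
        derivative_derivative_of_charTwo, Nat.cast_ofNat, map_ofNat, h2]
      linear_combination (e ^ 2 * s * derivative s * i * t ^ 2) * h2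
    · intro hdvd
      refine hu (hss.isUnit_of_dvd' dvd_rfl ?_)
      have h0 : i * t ≠ 0 := mul_ne_zero hi0 ht0
      refine (mul_dvd_mul_iff_right h0).1 (Dvd.dvd.trans ⟨t, ?_⟩ (hdvd.trans ?_))
      · rw [hfe]; ring
      · rw [mul_assoc]

theorem coeff_modByMonic_mul_sq [CharP k 2] {f u w : k[X]} (hf : f.Monic) (hd : 1 ≤ f.natDegree)
    (huw : derivative (u * f) = w ^ 2) (a : k[X]) :
    ((u * a ^ 2) %ₘ f).coeff (f.natDegree - 1) = ((w * a) %ₘ f).coeff (f.natDegree - 1) ^ 2 := by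
  have h2 : (2 : k[X]) = 0 := CharTwo.two_eq_zero
  set n := f.natDegree with hn
  have hf1 : f ≠ 1 := by rintro rfl; simp at hn; omega
  set r := (u * a ^ 2) %ₘ f
  set q := (u * a ^ 2) /ₘ f
  set ρ := (w * a) %ₘ f
  set σ := (w * a) /ₘ f
  have e1 : r + f * q = u * a ^ 2 := modByMonic_add_div _ _
  have e2 : ρ + f * σ = w * a := modByMonic_add_div _ _
  have dr : r.natDegree < n := natDegree_modByMonic_lt _ hf hf1
  have dρ : ρ.natDegree < n := natDegree_modByMonic_lt _ hf hf1
  have e3 : derivative (f * r) - ρ ^ 2 = f ^ 2 * (σ ^ 2 - derivative q) := by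
    have e4 : f * r = (u * f) * a ^ 2 - f ^ 2 * q := by linear_combination f * e1
    rw [e4, derivative_sub, derivative_mul, huw]
    simp only [derivative_mul, derivative_pow, Nat.cast_ofNat, map_ofNat, h2]
    linear_combination (-(ρ + f * σ) - w * a) * e2 + ρ * f * σ * h2
  have dfr : (f * r).natDegree ≤ n + (n - 1) :=
    natDegree_mul_le_of_le le_rfl (Nat.le_sub_one_of_lt dr)
  have dl : (derivative (f * r) - ρ ^ 2).natDegree ≤ 2 * n - 2 := by
    have d1 := natDegree_derivative_le (f * r)
    have d2 : (ρ ^ 2).natDegree ≤ 2 * ρ.natDegree := natDegree_pow_le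
    exact (natDegree_sub_le _ _).trans (max_le (by omega) (by omega))
  have e5 : derivative (f * r) = ρ ^ 2 := by
    rw [← sub_eq_zero]
    refine eq_zero_of_dvd_of_natDegree_lt ⟨_, e3⟩ ?_
    rw [hf.natDegree_pow]
    omega
  have e6 := congrArg (fun p => coeff p (2 * (n - 1))) e5
  have dρ' : ρ.natDegree ≤ n - 1 := by omega
  have dr' : r.natDegree ≤ n - 1 := by omega
  simp only [coeff_pow_of_natDegree_le dρ'] at e6
  rw [← e6, coeff_derivative, show 2 * (n - 1) + 1 = n + (n - 1) by omega,
    coeff_mul_add_eq_of_natDegree_le le_rfl dr', hn, hf.coeff_natDegree]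
  have h2' : (2 : k) = 0 := CharTwo.two_eq_zero
  push_cast
  rw [h2']
  ring

end Poly

theorem minpoly_symmetric_matrix_exists
    {k : Type*} [Field k] [CharP k 2] (n : ℕ) (hn : 1 ≤ n)
    (f : Polynomial k) (hmonic : f.Monic) (hdeg : f.natDegree = n)
    (h : ¬ (Squarefree f ∧
      ∀ g : Polynomial k, g.Monic → Irreducible g → g ∣ f → ¬ g.Separable)) :
    ∃ M : Matrix (Fin n) (Fin n) k, M.IsSymm ∧ minpoly k M = f := by
  obtain ⟨u, w, huf, huw, hfw⟩ := exists_isCoprime_derivative_mul_eq_sq f hmonic.ne_zero h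
  subst hdeg
  have hf1 : f ≠ 1 := by rintro rfl; simp at hn
  let ℓ : AdjoinRoot f →ₗ[k] k := lcoeff k (f.natDegree - 1) ∘ₗ AdjoinRoot.modByMonicHom hmonic
  have hℓ : ∀ a, ℓ (AdjoinRoot.mk f a) = (a %ₘ f).coeff (f.natDegree - 1) := fun a => by
    simp [ℓ, AdjoinRoot.modByMonicHom_mk]
  have hℓ0 : ∀ x : AdjoinRoot f, (∀ y, ℓ (x * y) = 0) → x = 0 := by
    intro x hx
    obtain ⟨a, rfl⟩ := AdjoinRoot.mk_surjective x
    rw [AdjoinRoot.mk_eq_zero, ← modByMonic_eq_zero_iff_dvd hmonic]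
    by_contra hr
    set r := a %ₘ f
    have hra : AdjoinRoot.mk f a = AdjoinRoot.mk f r := by
      rw [AdjoinRoot.mk_eq_mk]
      exact ⟨a /ₘ f, by linear_combination - (modByMonic_add_div a f)⟩
    have dr : r.natDegree < f.natDegree := natDegree_modByMonic_lt _ hmonic hf1
    have := hx (AdjoinRoot.mk f (X ^ (f.natDegree - 1 - r.natDegree)))
    rw [hra, ← map_mul, hℓ, (modByMonic_eq_self_iff hmonic).2] at this
    · rw [coeff_mul_X_pow', if_pos (by omega),
        show f.natDegree - 1 - (f.natDegree - 1 - r.natDegree) = r.natDegree by omega] at this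
      exact hr (leadingCoeff_eq_zero.1 this)
    · apply degree_lt_degree
      rw [natDegree_mul_X_pow _ hr]
      omega
  have hu : IsUnit (AdjoinRoot.mk f u) := by
    obtain ⟨a, b, hab⟩ := huf
    refine IsUnit.of_mul_eq_one (AdjoinRoot.mk f a) ?_
    rw [← map_mul, ← map_one (AdjoinRoot.mk f), AdjoinRoot.mk_eq_mk]
    exact ⟨-b, by linear_combination hab⟩
  let B : AdjoinRoot f →ₗ[k] AdjoinRoot f →ₗ[k] k :=
    (LinearMap.mul k (AdjoinRoot f)).compr₂ (ℓ ∘ₗ LinearMap.mulLeft k (AdjoinRoot.mk f u))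
  have hB : ∀ x y, B x y = ℓ (AdjoinRoot.mk f u * (x * y)) := fun _ _ => rfl
  let τ : AdjoinRoot f →ₗ[k] k := ℓ ∘ₗ LinearMap.mulLeft k (AdjoinRoot.mk f w)
  have : Module.Finite k (AdjoinRoot f) := hmonic.finite_adjoinRoot
  have hfr : Module.finrank k (AdjoinRoot f) = f.natDegree := by
    rw [(AdjoinRoot.powerBasis hmonic.ne_zero).finrank, AdjoinRoot.powerBasis_dim]
  obtain ⟨v, hv⟩ := exists_orthonormal_of_apply_self_eq_sq f.natDegree B τ hfr
    (fun x y => by rw [hB, hB, mul_comm x y])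
    (fun x hx => by
      have := hℓ0 (AdjoinRoot.mk f u * x) fun y => by rw [mul_assoc, ← hB, hx]
      exact hu.mul_right_eq_zero.1 this)
    (fun x => by
      obtain ⟨a, rfl⟩ := AdjoinRoot.mk_surjective x
      change ℓ (_ * (_ * _)) = ℓ (_ * _) ^ 2
      rw [← map_mul, ← map_mul, ← map_mul, hℓ, hℓ, ← coeff_modByMonic_mul_sq hmonic hn huw, sq])
    (fun h0 => hfw <| by
      rw [← AdjoinRoot.mk_eq_zero]
      exact hℓ0 _ fun y => LinearMap.congr_fun h0 y)
  have hrepr : ∀ (c : Fin f.natDegree → k) i, B (v i) (∑ j, c j • v j) = c i := fun c i => by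
    simp [hv]
  have hli : LinearIndependent k v := by
    rw [Fintype.linearIndependent_iff]
    intro c hc i
    rw [← hrepr c i, hc, map_zero]
  have : Nonempty (Fin f.natDegree) := ⟨⟨0, hn⟩⟩
  let b := basisOfLinearIndependentOfCardEqFinrank hli (by simp [hfr])
  have hb : ∀ i, b i = v i := fun i => by simp [b]
  have hbr : ∀ x i, b.repr x i = B (v i) x := fun x i => by
    conv_rhs => rw [← b.sum_repr x]
    simp only [hb]
    exact (hrepr _ i).symm
  refine ⟨Algebra.leftMulMatrix b (AdjoinRoot.root f), ?_, ?_⟩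
  · ext i j
    rw [Matrix.transpose_apply, Algebra.leftMulMatrix_eq_repr_mul,
      Algebra.leftMulMatrix_eq_repr_mul, hbr, hbr, hB, hB, hb, hb]
    congr 1
    ring
  · rw [minpoly.algHom_eq _ (Algebra.leftMulMatrix_injective b),
      AdjoinRoot.minpoly_root hmonic.ne_zero, hmonic.leadingCoeff]
    simp
end

section
/- Let k be a field of characteristic two and let f ∈ k[X] be a monic polynomial of degree ≥ 1 which is squarefree and every monic irreducible factor of which is inseparable (i.e., f is a product of pairwise distinct monic irreducible inseparable polynomials). Then for every m ≥ 1, there is no symmetric matrix M ∈ M_m(k) whose minimal polynomial over k equals f. -/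
open Polynomial

/-- A field of characteristic two has a basis over its subfield of squares; the coordinates are
recorded here through their square roots. -/
theorem exists_basis_over_squares.{u} (k : Type u) [Field k] [CharP k 2] :
    ∃ (ι : Type u) (e : ι → k),
      (∀ c : ι →₀ k, (c.sum fun i a => e i * a ^ 2) = 0 → c = 0) ∧
      ∀ a : k, ∃ c : ι →₀ k, a = c.sum fun i b => e i * b ^ 2 := by
  let F := (frobenius k 2).fieldRange
  let B := Module.Basis.ofVectorSpace F k
  refine ⟨_, B, fun c hc => ?_, fun a => ?_⟩
  · let d := c.mapRange (frobenius k 2).rangeRestrictField (map_zero _)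
    have hd : Finsupp.linearCombination F B d = 0 := by
      rw [Finsupp.linearCombination_apply, Finsupp.sum_mapRange_index (by simp), ← hc]
      refine Finsupp.sum_congr fun i _ => ?_
      rw [Subfield.smul_def, smul_eq_mul, mul_comm]
      rfl
    have hd0 : d = 0 := linearIndependent_iff.mp B.linearIndependent d hd
    ext i
    have hi : (frobenius k 2).rangeRestrictField (c i) = 0 := by
      simpa [d] using DFunLike.congr_fun hd0 i
    simpa using hi
  · have hs : ∀ z : F, ∃ b : k, b ^ 2 = z := fun z => z.2
    choose s hs using hs
    have s0 : s 0 = 0 := by simpa using hs 0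
    refine ⟨(B.repr a).mapRange s s0, ?_⟩
    rw [Finsupp.sum_mapRange_index (by simp)]
    conv_lhs => rw [← B.linearCombination_repr a, Finsupp.linearCombination_apply]
    refine Finsupp.sum_congr fun i _ => ?_
    rw [hs, Subfield.smul_def, smul_eq_mul, mul_comm]

theorem expand_two_eq_sum_squares {k ι : Type*} [Field k] [CharP k 2] (e : ι → k)
    (he : ∀ a : k, ∃ c : ι →₀ k, a = c.sum fun i b => e i * b ^ 2) (g : k[X]) :
    ∃ H : ι →₀ k[X], expand k 2 g = H.sum fun i h => C (e i) * h ^ 2 := by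
  classical
  induction g using Polynomial.induction_on' with
  | add p q hp hq =>
    obtain ⟨P, hP⟩ := hp
    obtain ⟨Q, hQ⟩ := hq
    refine ⟨P + Q, ?_⟩
    rw [map_add, hP, hQ, Finsupp.sum_add_index' (by simp)]
    intro i a b
    rw [CharTwo.add_sq, mul_add]
  | monomial n a =>
    obtain ⟨c, hc⟩ := he a
    refine ⟨c.mapRange (monomial n) (map_zero _), ?_⟩
    rw [Finsupp.sum_mapRange_index (by simp), expand_monomial, hc, Finsupp.sum, map_sum]
    refine Finset.sum_congr rfl fun i _ => ?_
    simp only [monomial_pow, C_mul_monomial]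

theorem derivative_eq_zero_of_factors_inseparable {k : Type*} [Field k] (f : k[X])
    (hf : f ≠ 0)
    (hinsep : ∀ g : k[X], g.Monic → Irreducible g → g ∣ f → ¬ g.Separable) :
    derivative f = 0 := by
  classical
  induction f using WfDvdMonoid.induction_on_irreducible with
  | zero => exact absurd rfl hf
  | unit u hu =>
    obtain ⟨c, -, rfl⟩ := Polynomial.isUnit_iff.mp hu
    exact derivative_C
  | mul a i ha hi ih =>
    have hda : derivative a = 0 :=
      ih ha fun g hm hg hd => hinsep g hm hg (hd.mul_left i)
    have hdi : derivative i = 0 := by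
      by_contra hne
      have hsep : i.Separable := (separable_iff_derivative_ne_zero hi).mpr hne
      have hassoc : Associated (normalize i) i := normalize_associated i
      exact hinsep (normalize i) (monic_normalize hi.ne_zero) (hassoc.irreducible_iff.mpr hi)
        (hassoc.dvd.trans (dvd_mul_right i a)) (hsep.of_dvd hassoc.dvd)
    rw [derivative_mul, hda, hdi, zero_mul, mul_zero, add_zero]

theorem Matrix.IsSymm.aeval {k n : Type*} [CommRing k] [Fintype n] [DecidableEq n]
    {M : Matrix n n k} (hM : M.IsSymm) (p : k[X]) : (Polynomial.aeval M p).IsSymm := by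
  induction p using Polynomial.induction_on' with
  | add p q hp hq => rw [map_add]; exact hp.add hq
  | monomial i a =>
    rw [aeval_monomial, ← Algebra.smul_def]
    exact (hM.pow i).smul a

theorem Matrix.IsSymm.sq_apply_self {k n : Type*} [CommRing k] [CharP k 2] [Fintype n]
    [DecidableEq n] {A : Matrix n n k} (hA : A.IsSymm) (j : n) :
    (A ^ 2) j j = (Matrix.vecMul 1 A j) ^ 2 := by
  rw [pow_two A, Matrix.mul_apply, Matrix.vecMul, one_dotProduct, CharTwo.sum_sq]
  refine Finset.sum_congr rfl fun i _ => ?_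
  rw [hA.apply i j, pow_two]

theorem not_minpoly_symmetric_of_squarefree_inseparable
    {k : Type*} [Field k] [CharP k 2]
    (f : Polynomial k) (hmonic : f.Monic) (hdeg : 1 ≤ f.natDegree)
    (hsq : Squarefree f)
    (hinsep : ∀ g : Polynomial k, g.Monic → Irreducible g → g ∣ f → ¬ g.Separable)
    (m : ℕ) (hm : 1 ≤ m) :
    ¬ ∃ M : Matrix (Fin m) (Fin m) k, M.IsSymm ∧ minpoly k M = f := by
  rintro ⟨M, hM, hMf⟩
  obtain ⟨ι, e, hind, hspan⟩ := exists_basis_over_squares k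
  obtain ⟨H, hH⟩ := expand_two_eq_sum_squares e hspan (contract 2 f)
  rw [expand_contract 2 (derivative_eq_zero_of_factors_inseparable f hmonic.ne_zero hinsep)
    two_ne_zero] at hH
  let I : Ideal k[X] :=
    { carrier := {h | Matrix.vecMul 1 (aeval M h) = 0}
      add_mem' := fun {a b} ha hb => by
        simp only [Set.mem_ofPred_eq] at ha hb ⊢
        rw [map_add, Matrix.vecMul_add, ha, hb, add_zero]
      zero_mem' := by simp
      smul_mem' := fun c h hh => by
        simp only [Set.mem_ofPred_eq] at hh ⊢
        rw [smul_eq_mul, mul_comm, map_mul, ← Matrix.vecMul_vecMul, hh, Matrix.zero_vecMul] }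
  have hHI : ∀ i, H i ∈ I := by
    intro i
    ext j
    let c : ι →₀ k := H.mapRange (fun h => Matrix.vecMul 1 (aeval M h) j) (by simp)
    have hc : (c.sum fun i a => e i * a ^ 2) = 0 := by
      have h0 : aeval M f = 0 := hMf ▸ minpoly.aeval k M
      rw [hH, Finsupp.sum, map_sum] at h0
      have hj := congrFun (congrFun h0 j) j
      rw [Matrix.sum_apply] at hj
      rw [Finsupp.sum_mapRange_index (by simp), ← Matrix.zero_apply j j, ← hj]
      refine Finset.sum_congr rfl fun i _ => ?_
      rw [map_mul, aeval_C, ← Algebra.smul_def, map_pow, Matrix.smul_apply, smul_eq_mul,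
        (hM.aeval (H i)).sq_apply_self]
    simpa [c] using DFunLike.congr_fun (hind c hc) i
  obtain ⟨r, hr⟩ : ∃ r, I = Ideal.span {r} := (IsPrincipalIdealRing.principal I).principal
  have hrf : r * r ∣ f := by
    rw [hH]
    refine Finset.dvd_sum fun i _ => Dvd.dvd.mul_left ?_ _
    have hri : r ∣ H i := Ideal.mem_span_singleton.mp (hr ▸ hHI i)
    rw [pow_two]
    exact mul_dvd_mul hri hri
  have htop : I = ⊤ := hr.trans (Ideal.span_singleton_eq_top.mpr (hsq r hrf))
  have h1 : Matrix.vecMul 1 (aeval M (1 : k[X])) = 0 := I.eq_top_iff_one.mp htop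
  rw [map_one, Matrix.vecMul_one] at h1
  exact one_ne_zero (congrFun h1 ⟨0, hm⟩)
end

section
/- Let k be a field of characteristic two and let α be an element of an algebraic closure of k that is algebraic of degree n over k, and assume the minimal polynomial of α over k is inseparable (not separable). Then there exists a symmetric matrix M ∈ M_{n+1}(k) such that α is a root of the characteristic polynomial of M, i.e., evaluating the characteristic polynomial of M at α (via the algebra map k[X] → algebraic closure of k) gives 0. -/
open Polynomial

namespace Matrix

/-- If `U` and `V` span totally isotropic subspaces that are dual to each other under the dot
product, then any pair of symmetric matrices `H`, `G⁻¹` with `H b = a ^ 2 G b` yields a symmetric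
matrix `U H Uᵀ + V G⁻¹ Vᵀ` with eigenvalue `a`. -/
lemma aeval_charpoly_eq_zero_of_isotropic_dual {k E ι κ : Type*} [Field k] [Field E] [Algebra k E]
    [Fintype ι] [DecidableEq ι] [Fintype κ] [DecidableEq κ]
    {U V : Matrix κ ι k} (hUU : Uᵀ * U = 0) (hVV : Vᵀ * V = 0) (hUV : Uᵀ * V = 1)
    {H G G' : Matrix ι ι k} (hG : G' * G = 1) {a : E} {b : ι → E} (hb : b ≠ 0)
    (hab : H.map (algebraMap k E) *ᵥ b = a ^ 2 • (G.map (algebraMap k E) *ᵥ b)) :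
    aeval a (U * H * Uᵀ + V * G' * Vᵀ).charpoly = 0 := by
  have hVU : Vᵀ * U = 1 := by
    rw [← transpose_transpose U, ← transpose_mul, hUV, transpose_one]
  set φ := algebraMap k E
  set M := U * H * Uᵀ + V * G' * Vᵀ with hM
  have hMU : M * U = V * G' := by
    simp [hM, Matrix.add_mul, Matrix.mul_assoc, hUU, hVU]
  have hMV : M * V = U * H := by
    simp [hM, Matrix.add_mul, Matrix.mul_assoc, hUV, hVV]
  have hMVG : M * (U * G) = V := by
    rw [← Matrix.mul_assoc, hMU, Matrix.mul_assoc, hG, Matrix.mul_one]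
  let x : κ → E := a • ((U * G).map φ *ᵥ b) + V.map φ *ᵥ b
  have hUx : Uᵀ.map φ *ᵥ x = b := by
    simp only [x, mulVec_add, mulVec_smul, mulVec_mulVec, ← Matrix.map_mul, ← Matrix.mul_assoc,
      hUU, hUV]
    simp
  have hx : x ≠ 0 := by
    rintro h
    exact hb (by rw [← hUx, h, mulVec_zero])
  have hMx : M.map φ *ᵥ x = a • x := by
    simp only [x, mulVec_add, mulVec_smul, mulVec_mulVec, ← Matrix.map_mul, hMVG, hMV]
    rw [Matrix.map_mul, ← mulVec_mulVec, hab, Matrix.map_mul, ← mulVec_mulVec, mulVec_smul,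
      smul_add, smul_smul, pow_two, add_comm]
  rw [aeval_def, ← eval_map, ← charpoly_map, eval_charpoly]
  refine exists_mulVec_eq_zero_iff.mp ⟨x, hx, ?_⟩
  rw [sub_mulVec, hMx, scalar_apply, ← smul_one_eq_diagonal, smul_mulVec, one_mulVec, sub_self]

/-- In characteristic two, `Rᵐ ⊕ Rᵐ ⊕ R` contains two totally isotropic subspaces of dimension `m`
that are dual to each other under the dot product. -/
lemma exists_isotropic_dual (R : Type*) [CommRing R] [CharP R 2] (m : ℕ) :
    ∃ U V : Matrix (Fin m ⊕ Fin m ⊕ Unit) (Fin m) R,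
      Uᵀ * U = 0 ∧ Vᵀ * V = 0 ∧ Uᵀ * V = 1 := by
  let T : Matrix (Fin m) (Fin m) R := of fun i j ↦ if i < j then 1 else 0
  let r : Matrix Unit (Fin m) R := of fun _ _ ↦ 1
  have hT : 1 + T + Tᵀ + rᵀ * r = 0 := by
    ext i j
    have h2 : (1 : R) + 1 = 0 := CharTwo.add_self_eq_zero 1
    rcases lt_trichotomy i j with h | h | h
    · simp [T, r, mul_apply, h, h.ne, h.not_gt, h2]
    · simp [T, r, mul_apply, h, h2]
    · simp [T, r, mul_apply, h, h.ne', h.not_gt, h2]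
  have hself {n p : Type} (A : Matrix n p R) : A + A = 0 := by
    ext i j
    exact CharTwo.add_self_eq_zero _
  refine ⟨fromRows 1 (fromRows 1 0), fromRows T (fromRows (1 + T) r), ?_, ?_, ?_⟩
  · simp [transpose_fromRows, fromCols_mul_fromRows, hself]
  · simp only [transpose_fromRows, fromCols_mul_fromRows, transpose_add, transpose_one]
    calc Tᵀ * T + ((1 + Tᵀ) * (1 + T) + rᵀ * r)
        = (Tᵀ * T + Tᵀ * T) + (1 + T + Tᵀ + rᵀ * r) := by noncomm_ring
      _ = 0 := by rw [hself, hT, add_zero]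
  · simp only [transpose_fromRows, fromCols_mul_fromRows, transpose_one, transpose_zero,
      Matrix.one_mul, Matrix.zero_mul, add_zero]
    rw [add_left_comm, hself, add_zero]

end Matrix

open Matrix in
/-- An integral element of degree `m` is a generalized eigenvalue of a pair of symmetric `m × m`
matrices, the second of which is invertible. -/
lemma IsIntegral.exists_isSymm_mulVec_eq_smul {k E : Type*} [Field k] [Field E] [Algebra k E]
    {β : E} (hβ : IsIntegral k β) :
    ∃ H G : Matrix (Fin (minpoly k β).natDegree) (Fin (minpoly k β).natDegree) k,
      H.IsSymm ∧ G.IsSymm ∧ IsUnit G.det ∧ ∃ b : Fin (minpoly k β).natDegree → E, b ≠ 0 ∧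
        H.map (algebraMap k E) *ᵥ b = β • (G.map (algebraMap k E) *ᵥ b) := by
  let pb := IntermediateField.adjoin.powerBasis hβ
  let B : Module.Basis (Fin (minpoly k β).natDegree) k _ := pb.basis
  obtain ⟨l, hl⟩ := Module.Projective.exists_dual_ne_zero k
    (one_ne_zero : (1 : IntermediateField.adjoin k {β}) ≠ 0)
  let A := Algebra.leftMulMatrix B pb.gen
  let G : Matrix (Fin (minpoly k β).natDegree) (Fin (minpoly k β).natDegree) k :=
    of fun i j ↦ l (B i * B j)
  have hGA (i j) : (G * A) i j = l (B i * (pb.gen * B j)) := by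
    conv_rhs => rw [← B.sum_repr (pb.gen * B j)]
    simp [G, A, mul_apply, Algebra.leftMulMatrix_eq_repr_mul, Finset.mul_sum, mul_comm,
      -Module.Basis.sum_repr]
  have hG : G.det ≠ 0 := by
    intro h
    obtain ⟨v, hv, hGv⟩ := exists_mulVec_eq_zero_iff.mpr h
    set x := ∑ j, v j • B j with hx
    have hlx : l ∘ₗ LinearMap.mulRight k x = 0 := by
      refine B.ext fun i ↦ ?_
      rw [LinearMap.zero_apply, ← Pi.zero_apply (M := fun _ ↦ k) i, ← hGv]
      simp [G, hx, mulVec, dotProduct, Finset.mul_sum, mul_comm]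
    have hx0 : x = 0 := by
      by_contra hx0
      refine hl ?_
      simpa [hx0] using LinearMap.congr_fun hlx x⁻¹
    exact hv (funext (Fintype.linearIndependent_iff.mp B.linearIndependent v hx0))
  obtain ⟨b, hb, hAb⟩ : ∃ b : Fin (minpoly k β).natDegree → E, b ≠ 0 ∧
      (scalar _ β - A.map (algebraMap k E)) *ᵥ b = 0 := by
    refine exists_mulVec_eq_zero_iff.mpr ?_
    rw [← eval_charpoly, charpoly_map, eval_map_algebraMap]
    have hA : A.charpoly = minpoly k β :=
      (charpoly_leftMulMatrix pb).trans (IntermediateField.minpoly_gen k β)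
    rw [hA, minpoly.aeval]
  refine ⟨G * A, G, ?_, ?_, hG.isUnit, b, hb, ?_⟩
  · ext i j
    rw [transpose_apply, hGA, hGA, mul_left_comm, mul_left_comm (B i), mul_comm (B j)]
  · ext i j
    simp [G, mul_comm]
  · rw [sub_mulVec, scalar_apply, ← smul_one_eq_diagonal, smul_mulVec, one_mulVec,
      sub_eq_zero] at hAb
    rw [Matrix.map_mul, ← mulVec_mulVec, ← hAb, mulVec_smul]

theorem eigenvalue_symmetric_matrix_of_inseparable
    {k : Type*} [Field k] [CharP k 2] (n : ℕ) (hn : 1 ≤ n)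
    (α : AlgebraicClosure k) (hint : IsIntegral k α)
    (hdeg : (minpoly k α).natDegree = n)
    (hinsep : ¬ (minpoly k α).Separable) :
    ∃ M : Matrix (Fin (n + 1)) (Fin (n + 1)) k, M.IsSymm ∧
      Polynomial.aeval α M.charpoly = 0 := by
  have hβ : IsIntegral k (α ^ 2) := hint.pow 2
  have hn2 : n = (minpoly k (α ^ 2)).natDegree * 2 := by
    have hirr := minpoly.irreducible hint
    have hder : derivative (minpoly k α) = 0 := by
      by_contra h
      exact hinsep ((separable_iff_derivative_ne_zero hirr).mpr h)
    have hexp := expand_contract 2 hder two_ne_zero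
    have hq : minpoly k (α ^ 2) = contract 2 (minpoly k α) := by
      refine (minpoly.eq_of_irreducible_of_monic ?_ ?_ ?_).symm
      · exact of_irreducible_expand two_ne_zero (hexp.symm ▸ hirr)
      · rw [← expand_aeval, hexp, minpoly.aeval]
      · exact (monic_expand_iff two_pos).mp (hexp.symm ▸ minpoly.monic hint)
    rw [hq, ← natDegree_expand, hexp, hdeg]
  obtain ⟨H, G, hH, hG, hdet, b, hb, hab⟩ := hβ.exists_isSymm_mulVec_eq_smul
  obtain ⟨U, V, hUU, hVV, hUV⟩ :=
    Matrix.exists_isotropic_dual k (minpoly k (α ^ 2)).natDegree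
  let e : Fin (minpoly k (α ^ 2)).natDegree ⊕ Fin (minpoly k (α ^ 2)).natDegree ⊕ Unit ≃
      Fin (n + 1) := Fintype.equivFinOfCardEq (by simp; omega)
  refine ⟨Matrix.reindex e e (U * H * U.transpose + V * G⁻¹ * V.transpose), ?_, ?_⟩
  · refine Matrix.IsSymm.submatrix (Matrix.IsSymm.add ?_ ?_) _
    · simp [Matrix.IsSymm, Matrix.transpose_mul, hH.eq, Matrix.mul_assoc]
    · simp [Matrix.IsSymm, Matrix.transpose_mul, Matrix.transpose_nonsing_inv, hG.eq,
        Matrix.mul_assoc]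
  · rw [Matrix.charpoly_reindex]
    exact Matrix.aeval_charpoly_eq_zero_of_isotropic_dual hUU hVV hUV
      (Matrix.nonsing_inv_mul G hdet) hb hab
end

section
/- Let k be a field of characteristic two, let f ∈ k[X] be a monic polynomial of degree 2m (m ≥ 1) such that f = g(X²) for some g ∈ k[X], and let α denote the image of X in E = k[X]/(f). Let s : E → k be the unique k-linear form with s(α^i) = 0 for 0 ≤ i ≤ 2m−2 and s(α^{2m−1}) = 1 (defined on the basis (1, α, …, α^{2m−1})). Then the transfer s_*⟨1⟩ is nondegenerate and alternating (hence hyperbolic). -/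
open Polynomial

/-- The transfer `s_*⟨1⟩` of a linear form `s` on a commutative algebra:
the bilinear form `(x, y) ↦ s (x * y)`. -/
def transfer {k E : Type*} [Field k] [CommRing E] [Algebra k E]
    (s : E →ₗ[k] k) : LinearMap.BilinForm k E :=
  (LinearMap.mul k E).compr₂ s

/-- A linear form on `k[X]/(f)` that vanishes on the powers of the root below the `n`-th one and
takes the value `1` there reads off the `n`-th coefficient of polynomials of degree at most `n`. -/
theorem AdjoinRoot.linearForm_mk_eq_coeff {k : Type*} [Field k] {f : k[X]} {n : ℕ}
    {s : AdjoinRoot f →ₗ[k] k} (hs0 : ∀ i < n, s (AdjoinRoot.root f ^ i) = 0)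
    (hs1 : s (AdjoinRoot.root f ^ n) = 1) {p : k[X]} (hp : p.natDegree ≤ n) :
    s (AdjoinRoot.mk f p) = p.coeff n := by
  have hterm (i : ℕ) : s (AdjoinRoot.mk f (C (p.coeff i) * X ^ i)) =
      p.coeff i * s (AdjoinRoot.root f ^ i) := by
    rw [← smul_eq_C_mul, ← AdjoinRoot.smul_mk, map_smul, map_pow, AdjoinRoot.mk_X, smul_eq_mul]
  conv_lhs => rw [p.as_sum_range_C_mul_X_pow' (Nat.lt_succ_of_le hp)]
  rw [map_sum, map_sum, Finset.sum_range_succ, hterm, hs1, mul_one,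
    Finset.sum_eq_zero, zero_add]
  intro i hi
  rw [hterm, hs0 i (Finset.mem_range.mp hi), mul_zero]

theorem transfer_apply {k E : Type*} [Field k] [CommRing E] [Algebra k E]
    (s : E →ₗ[k] k) (x y : E) : transfer s x y = s (x * y) :=
  rfl

theorem transfer_isSymm {k E : Type*} [Field k] [CommRing E] [Algebra k E]
    (s : E →ₗ[k] k) : (transfer s).IsSymm :=
  ⟨fun x y => by simp [transfer_apply, mul_comm]⟩

theorem AdjoinRoot.transfer_nondegenerate {k : Type*} [Field k] {f : k[X]} (hf : f.Monic) {n : ℕ}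
    (hdeg : f.natDegree = n + 1) {s : AdjoinRoot f →ₗ[k] k}
    (hs0 : ∀ i < n, s (AdjoinRoot.root f ^ i) = 0)
    (hs1 : s (AdjoinRoot.root f ^ n) = 1) : (transfer s).Nondegenerate := by
  refine (transfer_isSymm s).isRefl.nondegenerate_iff_separatingLeft.mpr ?_
  intro x hx
  obtain ⟨q, rfl⟩ := AdjoinRoot.mk_surjective x
  have hqr : AdjoinRoot.mk f q = AdjoinRoot.mk f (q %ₘ f) := by
    conv_lhs => rw [← modByMonic_add_div q f]
    simp
  rw [hqr] at hx ⊢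
  set p := q %ₘ f
  have hpn : p.natDegree ≤ n := by
    have : p.natDegree < f.natDegree :=
      natDegree_modByMonic_lt q hf (fun h => by simp [h] at hdeg)
    omega
  have h := hx (AdjoinRoot.mk f (X ^ (n - p.natDegree)))
  rw [transfer_apply, ← map_mul, linearForm_mk_eq_coeff hs0 hs1, coeff_mul_X_pow',
    if_pos (Nat.sub_le _ _), Nat.sub_sub_self hpn, coeff_natDegree, leadingCoeff_eq_zero] at h
  · rw [h, map_zero]
  · refine natDegree_mul_le.trans ?_
    rw [natDegree_X_pow]
    omega

theorem AdjoinRoot.transfer_isAlt_of_expand {k : Type*} [Field k] [CharP k 2] {g : k[X]}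
    (hg : g.Monic) {n : ℕ} (hdeg : (expand k 2 g).natDegree = n + 1)
    {s : AdjoinRoot (expand k 2 g) →ₗ[k] k}
    (hs0 : ∀ i < n, s (AdjoinRoot.root (expand k 2 g) ^ i) = 0)
    (hs1 : s (AdjoinRoot.root (expand k 2 g) ^ n) = 1) : (transfer s).IsAlt := by
  intro x
  obtain ⟨p, rfl⟩ := AdjoinRoot.mk_surjective x
  have : Fact (Nat.Prime 2) := ⟨Nat.prime_two⟩
  rw [natDegree_expand] at hdeg
  set q := p.map (frobenius k 2) with hq
  have hsq : p * p = expand k 2 q := by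
    rw [hq, ← map_expand, map_frobenius_expand, sq]
  have hmk : AdjoinRoot.mk (expand k 2 g) (expand k 2 q) =
      AdjoinRoot.mk (expand k 2 g) (expand k 2 (q %ₘ g)) := by
    conv_lhs => rw [← modByMonic_add_div q g]
    simp
  have hlt : (q %ₘ g).natDegree < g.natDegree :=
    natDegree_modByMonic_lt q hg (fun h => by simp [h] at hdeg)
  rw [transfer_apply, ← map_mul, hsq, hmk, linearForm_mk_eq_coeff hs0 hs1,
    coeff_expand two_pos, if_neg (by omega)]
  rw [natDegree_expand]
  omega

theorem transfer_nondegenerate_alt_of_even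
    {k : Type*} [Field k] [CharP k 2] (m : ℕ) (hm : 1 ≤ m)
    (f : Polynomial k) (hmonic : f.Monic) (hdeg : f.natDegree = 2 * m)
    (g : Polynomial k) (hfg : f = g.comp (X ^ 2))
    (s : AdjoinRoot f →ₗ[k] k)
    (hs0 : ∀ i < 2 * m - 1, s (AdjoinRoot.root f ^ i) = 0)
    (hs1 : s (AdjoinRoot.root f ^ (2 * m - 1)) = 1) :
    (transfer s).Nondegenerate ∧ (transfer s).IsAlt := by
  have hdeg' : f.natDegree = 2 * m - 1 + 1 := by omega
  rw [← expand_eq_comp_X_pow] at hfg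
  subst hfg
  exact ⟨AdjoinRoot.transfer_nondegenerate hmonic hdeg' hs0 hs1,
    AdjoinRoot.transfer_isAlt_of_expand ((monic_expand_iff two_pos).mp hmonic) hdeg' hs0 hs1⟩
end

section
/- Let k be a field, let π ∈ k[X] be a monic irreducible separable polynomial, let a be a root of π in an algebraic closure of k, let L = k(a), and let m ≥ 1. Then for every polynomial Q ∈ L[X] there exists a polynomial P ∈ k[X] such that (X − a)^m divides P − Q in L[X], i.e., P and Q have the same image in L[X]/((X − a)^m). -/
open Polynomial

theorem exists_lift_mod_pow_of_separable
    {k L : Type*} [Field k] [Field L] [Algebra k L]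
    (π : Polynomial k) (hπm : π.Monic) (hπi : Irreducible π) (hπs : π.Separable)
    (a : L) (ha : Polynomial.aeval a π = 0) (hgen : Algebra.adjoin k {a} = ⊤)
    (m : ℕ) (hm : 1 ≤ m) (Q : Polynomial L) :
    ∃ P : Polynomial k, (X - C a) ^ m ∣ (P.map (algebraMap k L) - Q) := by
  clear hm
  obtain ⟨g, hg⟩ : (X - C a) ∣ π.map (algebraMap k L) := by
    rw [dvd_iff_isRoot, IsRoot.def, eval_map_algebraMap, ha]
  have hga : g.eval a ≠ 0 := by
    have h := hπs.aeval_derivative_ne_zero ha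
    rw [← eval_map_algebraMap, ← derivative_map, hg] at h
    simpa using h
  induction m with
  | zero => exact ⟨0, by simp⟩
  | succ m ih =>
    obtain ⟨P, R, hR⟩ := ih
    obtain ⟨S, hS⟩ : ∃ S : k[X], aeval a S = -(R.eval a) / g.eval a ^ m := by
      have h : -(R.eval a) / g.eval a ^ m ∈ Algebra.adjoin k {a} := hgen ▸ Algebra.mem_top
      rwa [Algebra.adjoin_singleton_eq_range_aeval] at h
    refine ⟨P + π ^ m * S, ?_⟩
    have key : (P + π ^ m * S).map (algebraMap k L) - Q =
        (X - C a) ^ m * (R + g ^ m * S.map (algebraMap k L)) := by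
      rw [Polynomial.map_add, Polynomial.map_mul, Polynomial.map_pow, hg, mul_pow]
      linear_combination hR
    rw [key, pow_succ]
    refine mul_dvd_mul_left _ ?_
    rw [dvd_iff_isRoot, IsRoot.def, eval_add, eval_mul, eval_pow, eval_map_algebraMap, hS]
    field_simp
    ring
end

section
/- Let K be a field of characteristic two, let m ≥ 1, and let N ∈ M_m(K) be a symmetric matrix such that N² = c·I_m for some c ∈ K. Then c is a square in K; in fact c = (Σ_{ℓ=1}^m N_{1ℓ})². -/
theorem sq_eq_of_symm_matrix_sq_scalar
    {K : Type*} [Field K] [CharP K 2] (m : ℕ) (hm : 1 ≤ m)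
    (N : Matrix (Fin m) (Fin m) K) (hN : N.IsSymm) (c : K)
    (hc : N ^ 2 = c • (1 : Matrix (Fin m) (Fin m) K)) :
    c = (∑ ℓ : Fin m, N ⟨0, hm⟩ ℓ) ^ 2 := by
  have h : (N ^ 2) ⟨0, hm⟩ ⟨0, hm⟩ = c := by
    rw [hc, Matrix.smul_apply, Matrix.one_apply_eq, smul_eq_mul, mul_one]
  rw [← h, CharTwo.sum_sq, sq N, Matrix.mul_apply]
  refine Finset.sum_congr rfl fun ℓ _ => ?_
  rw [hN.apply, sq]
end
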